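/- Let (ρ_t)_{t∈ℕ} be a dynamic convex risk measure for processes. Then: (a) (ρ_t) is acceptance consistent, i.e. ρ_t(X) ≤ ρ_t(X_t·1_{{t}} − ρ_{t+1}(X)·1_{𝕋_{t+1}}) P-a.s. for all t and X ∈ ℛ^∞, if and only if 𝒜_t ⊇ 𝒜_{t,t+1} + 𝒜_{t+1} for all t; (b) (ρ_t) is rejection consistent, i.e. ρ_t(X) ≥ ρ_t(X_t·1_{{t}} − ρ_{t+1}(X)·1_{𝕋_{t+1}}) P-a.s. for all t and X ∈ ℛ^∞, if and only if 𝒜_t ⊆ 𝒜_{t,t+1} + 𝒜_{t+1} for all t. Here X_t·1_{{t}} − ρ_{t+1}(X)·1_{𝕋_{t+1}} denotes the process equal to 0 at times s < t, to X_t at time t, and to −ρ_{t+1}(X) at all times s ≥ t+1, and sums of sets are setwise sums with componentwise addition of processes. -/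

import Mathlib

open MeasureTheory Filter

variable {Ω : Type*}

/-- Bounded measurable real-valued functions with respect to a σ-algebra (the space `L^∞`). -/
def BddMeas {α : Type*} (mm : MeasurableSpace α) (f : α → ℝ) : Prop :=
  Measurable[mm] f ∧ ∃ C : ℝ, ∀ x, |f x| ≤ C

/-- The space `ℛ^∞` of bounded adapted processes. -/
def MemRinf {m : MeasurableSpace Ω} (F : Filtration ℕ m) (X : ℕ → Ω → ℝ) : Prop :=
  (∀ s, Measurable[F s] (X s)) ∧ ∃ C : ℝ, ∀ s ω, |X s ω| ≤ C

/-- The projection `π_t` killing a process strictly before time `t`. -/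
def projt (t : ℕ) (X : ℕ → Ω → ℝ) : ℕ → Ω → ℝ := fun r ω => if t ≤ r then X r ω else 0

/-- Membership in `ℛ_t^∞ = π_t(ℛ^∞)`: bounded adapted processes vanishing before `t`. -/
def MemRt {m : MeasurableSpace Ω} (F : Filtration ℕ m) (t : ℕ) (X : ℕ → Ω → ℝ) : Prop :=
  MemRinf F X ∧ ∀ r < t, ∀ ω, X r ω = 0

/-- A conditional convex risk measure for processes at time `t`:  a map
`ρ_t : ℛ_t^∞ → L^∞_t` which is conditionally cash invariant, monotone, conditionally
convex and normalized. -/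
structure IsCondRiskMeasure {m : MeasurableSpace Ω} (F : Filtration ℕ m) (P : Measure Ω)
    (t : ℕ) (ρ : (ℕ → Ω → ℝ) → Ω → ℝ) : Prop where
  map_into : ∀ X, MemRt F t X → BddMeas (F t) (ρ X)
  cash : ∀ X, MemRt F t X → ∀ mf : Ω → ℝ, BddMeas (F t) mf →
    ρ (fun r ω => X r ω + if t ≤ r then mf ω else 0) =ᵐ[P] fun ω => ρ X ω - mf ω
  mono : ∀ X Y, MemRt F t X → MemRt F t Y → (∀ s, ∀ᵐ ω ∂P, X s ω ≤ Y s ω) →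
    ∀ᵐ ω ∂P, ρ Y ω ≤ ρ X ω
  convex : ∀ X Y, MemRt F t X → MemRt F t Y → ∀ lam : Ω → ℝ,
    Measurable[F t] lam → (∀ ω, 0 ≤ lam ω ∧ lam ω ≤ 1) →
    ∀ᵐ ω ∂P, ρ (fun r ω => lam ω * X r ω + (1 - lam ω) * Y r ω) ω ≤
      lam ω * ρ X ω + (1 - lam ω) * ρ Y ω
  norm : ρ (fun _ _ => 0) =ᵐ[P] (0 : Ω → ℝ)

/-- Time consistency of a dynamic convex risk measure for processes. -/
def TimeConsistent {m : MeasurableSpace Ω} (F : Filtration ℕ m) (P : Measure Ω)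
    (ρ : ℕ → (ℕ → Ω → ℝ) → Ω → ℝ) : Prop :=
  ∀ t (X Y : ℕ → Ω → ℝ), MemRinf F X → MemRinf F Y →
    X t =ᵐ[P] Y t →
    (∀ᵐ ω ∂P, ρ (t + 1) (projt (t + 1) X) ω ≤ ρ (t + 1) (projt (t + 1) Y) ω) →
    ∀ᵐ ω ∂P, ρ t (projt t X) ω ≤ ρ t (projt t Y) ω

/-- The process `X_t·1_{{t}} − ρ_{t+1}(X)·1_{𝕋_{t+1}}`. -/
def oneStepTarget (ρ : ℕ → (ℕ → Ω → ℝ) → Ω → ℝ) (t : ℕ) (X : ℕ → Ω → ℝ) :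
    ℕ → Ω → ℝ :=
  fun r ω => if r = t then X t ω else if t + 1 ≤ r then -ρ (t + 1) (projt (t + 1) X) ω else 0

/-- The acceptance set `𝒜_t` of a conditional convex risk measure for processes. -/
def AcceptSet {m : MeasurableSpace Ω} (F : Filtration ℕ m) (P : Measure Ω) (t : ℕ)
    (ρ : (ℕ → Ω → ℝ) → Ω → ℝ) : Set (ℕ → Ω → ℝ) :=
  {X | MemRt F t X ∧ ∀ᵐ ω ∂P, ρ X ω ≤ 0}

/-- The one-step acceptance set `𝒜_{t,t+1}`: acceptable processes in `ℛ_{t,t+1}^∞`. -/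
def AcceptSetStep {m : MeasurableSpace Ω} (F : Filtration ℕ m) (P : Measure Ω) (t : ℕ)
    (ρ : (ℕ → Ω → ℝ) → Ω → ℝ) : Set (ℕ → Ω → ℝ) :=
  {X | MemRt F t X ∧ (∀ r, t + 1 ≤ r → X r = X (t + 1)) ∧ ∀ᵐ ω ∂P, ρ X ω ≤ 0}

/-- Acceptance consistency: `ρ_t(X) ≤ ρ_t(X_t·1_{{t}} − ρ_{t+1}(X)·1_{𝕋_{t+1}})` a.s. -/
def AcceptanceConsistent {m : MeasurableSpace Ω} (F : Filtration ℕ m) (P : Measure Ω)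
    (ρ : ℕ → (ℕ → Ω → ℝ) → Ω → ℝ) : Prop :=
  ∀ t, ∀ X : ℕ → Ω → ℝ, MemRinf F X →
    ∀ᵐ ω ∂P, ρ t (projt t X) ω ≤ ρ t (oneStepTarget ρ t X) ω

/-- Rejection consistency: `ρ_t(X) ≥ ρ_t(X_t·1_{{t}} − ρ_{t+1}(X)·1_{𝕋_{t+1}})` a.s. -/
def RejectionConsistent {m : MeasurableSpace Ω} (F : Filtration ℕ m) (P : Measure Ω)
    (ρ : ℕ → (ℕ → Ω → ℝ) → Ω → ℝ) : Prop :=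
  ∀ t, ∀ X : ℕ → Ω → ℝ, MemRinf F X →
    ∀ᵐ ω ∂P, ρ t (oneStepTarget ρ t X) ω ≤ ρ t (projt t X) ω

section RiskMeasureAux

variable {m : MeasurableSpace Ω} {F : Filtration ℕ m} {P : Measure Ω} {t : ℕ}

theorem BddMeas.neg {f : Ω → ℝ} (hf : BddMeas (F t) f) : BddMeas (F t) (fun ω => -f ω) := by
  obtain ⟨hm, C, hC⟩ := hf
  exact ⟨hm.neg, C, fun ω => by simpa using hC ω⟩

theorem MemRinf.add {X Y : ℕ → Ω → ℝ} (hX : MemRinf F X) (hY : MemRinf F Y) :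
    MemRinf F (fun r ω => X r ω + Y r ω) := by
  obtain ⟨hXm, C, hC⟩ := hX
  obtain ⟨hYm, D, hD⟩ := hY
  exact ⟨fun s => (hXm s).add (hYm s), C + D,
    fun s ω => (abs_add_le _ _).trans (add_le_add (hC s ω) (hD s ω))⟩

theorem MemRinf.bddMeas {X : ℕ → Ω → ℝ} (hX : MemRinf F X) (s : ℕ) : BddMeas (F s) (X s) :=
  ⟨hX.1 s, hX.2.imp fun _ hC => hC s⟩

theorem MemRt.add {X Y : ℕ → Ω → ℝ} (hX : MemRt F t X) (hY : MemRt F t Y) :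
    MemRt F t (fun r ω => X r ω + Y r ω) :=
  ⟨hX.1.add hY.1, fun r hr ω => by simp [hX.2 r hr ω, hY.2 r hr ω]⟩

theorem MemRt.mono_time {s : ℕ} {X : ℕ → Ω → ℝ} (hX : MemRt F s X) (hts : t ≤ s) :
    MemRt F t X :=
  ⟨hX.1, fun r hr => hX.2 r (hr.trans_le hts)⟩

theorem MemRinf.memRt_projt {X : ℕ → Ω → ℝ} (hX : MemRinf F X) (t : ℕ) :
    MemRt F t (projt t X) := by
  obtain ⟨hXm, C, hC⟩ := hX
  refine ⟨⟨fun s => ?_, C, fun s ω => ?_⟩, fun r hr ω => by simp [projt, not_le.2 hr]⟩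
  · by_cases h : t ≤ s
    · simpa +unfoldPartialApp [projt, h] using hXm s
    · simp +unfoldPartialApp [projt, h]
  · by_cases h : t ≤ s
    · simpa [projt, h] using hC s ω
    · simpa [projt, h] using (abs_nonneg _).trans (hC s ω)

theorem BddMeas.memRt_indicator {f : Ω → ℝ} (hf : BddMeas (F t) f) :
    MemRt F t (fun r ω => if t ≤ r then f ω else 0) := by
  obtain ⟨hm, C, hC⟩ := hf
  refine ⟨⟨fun s => ?_, C, fun s ω => ?_⟩, fun r hr ω => by simp [not_le.2 hr]⟩
  · by_cases h : t ≤ s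
    · simpa [h] using hm.mono (F.mono h) le_rfl
    · simp [h]
  · by_cases h : t ≤ s
    · simpa [h] using hC ω
    · simpa [h] using (abs_nonneg _).trans (hC ω)

theorem MemRt.projt_eq {X : ℕ → Ω → ℝ} (hX : MemRt F t X) : projt t X = X := by
  funext r ω
  by_cases h : t ≤ r
  · simp [projt, h]
  · simp [projt, h, hX.2 r (not_le.1 h) ω]

variable {ρ : ℕ → (ℕ → Ω → ℝ) → Ω → ℝ}

theorem MemRinf.memRt_oneStepTarget (hρ : IsCondRiskMeasure F P (t + 1) (ρ (t + 1)))
    {X : ℕ → Ω → ℝ} (hX : MemRinf F X) : MemRt F t (oneStepTarget ρ t X) := by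
  have hX_bdd := hX.bddMeas t
  have hR := (hρ.map_into _ (hX.memRt_projt (t + 1))).neg
  obtain ⟨hXm, C, hC⟩ := hX_bdd
  obtain ⟨hRm, D, hD⟩ := hR
  refine ⟨⟨fun s => ?_, max (max C D) 0, fun s ω => ?_⟩, fun r hr ω => ?_⟩
  · rcases lt_trichotomy s t with h | rfl | h
    · simp +unfoldPartialApp [oneStepTarget, h.ne, not_le.2 (h.trans (Nat.lt_succ_self t))]
    · simpa +unfoldPartialApp [oneStepTarget] using hXm
    · have h' : t + 1 ≤ s := h
      simpa +unfoldPartialApp [oneStepTarget, h.ne', h'] using hRm.mono (F.mono h') le_rfl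
  · simp only [oneStepTarget]
    split_ifs
    · exact (hC ω).trans ((le_max_left _ _).trans (le_max_left _ _))
    · exact (hD ω).trans ((le_max_right _ _).trans (le_max_left _ _))
    · simp
  · simp [oneStepTarget, hr.ne, not_le.2 (hr.trans (Nat.lt_succ_self t))]

/-- Adding the conditional risk as a cash amount makes a process acceptable. -/
theorem IsCondRiskMeasure.add_self_mem_acceptSet {σ : (ℕ → Ω → ℝ) → Ω → ℝ}
    (hσ : IsCondRiskMeasure F P t σ) {X : ℕ → Ω → ℝ} (hX : MemRt F t X) :
    (fun r ω => X r ω + if t ≤ r then σ X ω else 0) ∈ AcceptSet F P t σ := by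
  refine ⟨hX.add (hσ.map_into X hX).memRt_indicator, ?_⟩
  filter_upwards [hσ.cash X hX _ (hσ.map_into X hX)] with ω hω
  simp [hω]

/-- The one-step target of `Y + W`, with `Y` constant from time `t + 1` on and `W` acceptable
at time `t + 1`, is at most as risky as `Y`. -/
theorem oneStepTarget_add_le (hρ : ∀ t, IsCondRiskMeasure F P t (ρ t)) {Y W : ℕ → Ω → ℝ}
    (hY : MemRt F t Y) (hY_const : ∀ r, t + 1 ≤ r → Y r = Y (t + 1))
    (hW : W ∈ AcceptSet F P (t + 1) (ρ (t + 1))) :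
    ∀ᵐ ω ∂P, ρ t (oneStepTarget ρ t (fun r ω => Y r ω + W r ω)) ω ≤ ρ t Y ω := by
  obtain ⟨hW_mem, hW_acc⟩ := hW
  refine (hρ t).mono _ _ hY ((hY.1.add hW_mem.1).memRt_oneStepTarget (hρ (t + 1))) fun s => ?_
  have hproj : projt (t + 1) (fun r ω => Y r ω + W r ω) =
      fun r ω => W r ω + if t + 1 ≤ r then Y (t + 1) ω else 0 := by
    funext r ω
    by_cases h : t + 1 ≤ r
    · simp [projt, h, hY_const r h, add_comm]
    · simp [projt, h, hW_mem.2 r (not_le.1 h) ω]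
  filter_upwards [hW_acc, (hρ (t + 1)).cash W hW_mem _ (hY.1.bddMeas (t + 1))] with ω hacc hcash
  rcases lt_trichotomy s t with h | rfl | h
  · simp [oneStepTarget, h.ne, not_le.2 (h.trans (Nat.lt_succ_self t)), hY.2 s h ω]
  · simp [oneStepTarget, hW_mem.2 s (Nat.lt_succ_self s) ω]
  · have h' : t + 1 ≤ s := h
    simp only [oneStepTarget, h.ne', h', if_true, if_false, hproj, hcash, hY_const s h']
    linarith

/-- Conditional cash invariance of the one-step risk. -/
theorem oneStepTarget_cash (hρ : ∀ t, IsCondRiskMeasure F P t (ρ t)) {X : ℕ → Ω → ℝ}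
    (hX : MemRinf F X) {f : Ω → ℝ} (hf : BddMeas (F t) f) :
    ∀ᵐ ω ∂P, ρ t (oneStepTarget ρ t (fun r ω => projt t X r ω + if t ≤ r then f ω else 0)) ω =
      ρ t (oneStepTarget ρ t X) ω - f ω := by
  have hZ := (hX.memRt_projt t).add hf.memRt_indicator
  have hTX := hX.memRt_oneStepTarget (hρ (t + 1))
  have hTX' := hTX.add hf.memRt_indicator
  have hTZ := hZ.1.memRt_oneStepTarget (hρ (t + 1))
  have hf' : BddMeas (F (t + 1)) f := ⟨hf.1.mono (F.mono (Nat.le_succ t)) le_rfl, hf.2⟩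
  have hproj : projt (t + 1) (fun r ω => projt t X r ω + if t ≤ r then f ω else 0) =
      fun r ω => projt (t + 1) X r ω + if t + 1 ≤ r then f ω else 0 := by
    funext r ω
    by_cases h : t + 1 ≤ r
    · simp [projt, h, (Nat.le_succ t).trans h]
    · simp [projt, h]
  have heq : ∀ s, ∀ᵐ ω ∂P,
      oneStepTarget ρ t (fun r ω => projt t X r ω + if t ≤ r then f ω else 0) s ω =
        oneStepTarget ρ t X s ω + if t ≤ s then f ω else 0 := by
    intro s
    filter_upwards [(hρ (t + 1)).cash _ (hX.memRt_projt (t + 1)) f hf'] with ω hcash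
    rcases lt_trichotomy s t with h | rfl | h
    · simp [oneStepTarget, h.ne, not_le.2 h, not_le.2 (h.trans (Nat.lt_succ_self t))]
    · simp [oneStepTarget, projt]
    · have h' : t + 1 ≤ s := h
      simp only [oneStepTarget, h.ne', h', h.le, if_true, if_false, hproj, hcash]
      ring
  filter_upwards [(hρ t).mono _ _ hTZ hTX' fun s => (heq s).mono fun _ h => h.le,
    (hρ t).mono _ _ hTX' hTZ fun s => (heq s).mono fun _ h => h.ge,
    (hρ t).cash _ hTX f hf] with ω h1 h2 h3
  rw [← h3]
  exact le_antisymm h2 h1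

/-- A process is the sum of its one-step target and its risk-adjusted tail. -/
theorem oneStepTarget_add_tail (ρ : ℕ → (ℕ → Ω → ℝ) → Ω → ℝ) (t : ℕ) (X : ℕ → Ω → ℝ)
    (r : ℕ) (ω : Ω) :
    oneStepTarget ρ t X r ω + (projt (t + 1) X r ω +
      if t + 1 ≤ r then ρ (t + 1) (projt (t + 1) X) ω else 0) = projt t X r ω := by
  rcases lt_trichotomy r t with h | rfl | h
  · simp [oneStepTarget, projt, h.ne, not_le.2 h, not_le.2 (h.trans (Nat.lt_succ_self t))]
  · simp [oneStepTarget, projt]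
  · have h' : t + 1 ≤ r := h
    simp [oneStepTarget, projt, h.ne', h', h.le]

theorem oneStepTarget_const (ρ : ℕ → (ℕ → Ω → ℝ) → Ω → ℝ) (X : ℕ → Ω → ℝ) {r : ℕ}
    (hr : t + 1 ≤ r) : oneStepTarget ρ t X r = oneStepTarget ρ t X (t + 1) := by
  funext ω
  simp [oneStepTarget, hr, (Nat.lt_of_succ_le hr).ne']

end RiskMeasureAux

/-- **Characterization of acceptance and rejection consistency via acceptance sets.**
A dynamic convex risk measure for processes `(ρ_t)` is acceptance consistent iff
`𝒜_t ⊇ 𝒜_{t,t+1} + 𝒜_{t+1}` for all `t`, and rejection consistent iff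
`𝒜_t ⊆ 𝒜_{t,t+1} + 𝒜_{t+1}` for all `t`. -/
theorem stmt_10 {Ω : Type*} {m : MeasurableSpace Ω} (F : Filtration ℕ m)
    (P : Measure Ω) [IsProbabilityMeasure P]
    (hF0 : ∀ A : Set Ω, MeasurableSet[F 0] A → P A = 0 ∨ P A = 1)
    (ρ : ℕ → (ℕ → Ω → ℝ) → Ω → ℝ)
    (hρ : ∀ t, IsCondRiskMeasure F P t (ρ t)) :
    (AcceptanceConsistent F P ρ ↔
      ∀ t, {Z | ∃ Y ∈ AcceptSetStep F P t (ρ t), ∃ W ∈ AcceptSet F P (t + 1) (ρ (t + 1)),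
          Z = fun r ω => Y r ω + W r ω} ⊆ AcceptSet F P t (ρ t)) ∧
    (RejectionConsistent F P ρ ↔
      ∀ t, AcceptSet F P t (ρ t) ⊆
        {Z | ∃ Y ∈ AcceptSetStep F P t (ρ t), ∃ W ∈ AcceptSet F P (t + 1) (ρ (t + 1)),
          Z = fun r ω => Y r ω + W r ω}) := by
  refine ⟨⟨?_, ?_⟩, ⟨?_, ?_⟩⟩
  · rintro hA t Z ⟨Y, ⟨hY, hY_const, hY_acc⟩, W, hW, rfl⟩
    have hZ := hY.add (hW.1.mono_time (Nat.le_succ t))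
    refine ⟨hZ, ?_⟩
    have hA' := hA t _ hZ.1
    rw [hZ.projt_eq] at hA'
    filter_upwards [hA', oneStepTarget_add_le hρ hY hY_const hW, hY_acc] with ω h1 h2 h3
    exact h1.trans (h2.trans h3)
  · intro hS t X hX
    have hT := hX.memRt_oneStepTarget (hρ (t + 1))
    have hY := (hρ t).add_self_mem_acceptSet hT
    have hZ := hS t ⟨_, ⟨hY.1, fun r hr => ?_, hY.2⟩, _,
      (hρ (t + 1)).add_self_mem_acceptSet (hX.memRt_projt (t + 1)), rfl⟩
    · have hZ_eq : (fun r ω => (oneStepTarget ρ t X r ω +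
          if t ≤ r then ρ t (oneStepTarget ρ t X) ω else 0) + (projt (t + 1) X r ω +
            if t + 1 ≤ r then ρ (t + 1) (projt (t + 1) X) ω else 0)) =
          fun r ω => projt t X r ω + if t ≤ r then ρ t (oneStepTarget ρ t X) ω else 0 := by
        funext r ω
        rw [← oneStepTarget_add_tail ρ t X r ω]
        ring
      rw [hZ_eq] at hZ
      filter_upwards [hZ.2, (hρ t).cash _ (hX.memRt_projt t) _ ((hρ t).map_into _ hT)]
        with ω h1 h2
      linarith
    · funext ω
      simp [oneStepTarget_const ρ X hr, (Nat.le_succ t).trans hr]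
  · rintro hR t X ⟨hX, hX_acc⟩
    have hR' := hR t X hX.1
    rw [hX.projt_eq] at hR'
    refine ⟨_, ⟨hX.1.memRt_oneStepTarget (hρ (t + 1)), fun r => oneStepTarget_const ρ X, ?_⟩, _,
      (hρ (t + 1)).add_self_mem_acceptSet (hX.1.memRt_projt (t + 1)), ?_⟩
    · filter_upwards [hR', hX_acc] with ω h1 h2
      exact h1.trans h2
    · funext r ω
      rw [oneStepTarget_add_tail, hX.projt_eq]
  · intro hS t X hX
    have hX' := hX.memRt_projt t
    obtain ⟨Y, ⟨hY, hY_const, hY_acc⟩, W, hW, hYW⟩ := hS t ((hρ t).add_self_mem_acceptSet hX')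
    have hle := oneStepTarget_add_le hρ hY hY_const hW
    rw [← hYW] at hle
    filter_upwards [hle, hY_acc, oneStepTarget_cash hρ hX ((hρ t).map_into _ hX')] with ω h1 h2 h3
    linarith
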